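/- Assume Ω satisfies the p-Sobolev–Poincaré inequality with constant C₀ for some p with 1 < p ≤ n/(n−1). Then there is a constant C depending only on p and C₀ (in particular independent of q) such that for every q ∈ [1, ∞) and every f ∈ W(Ω) with |∇f| ∈ L^q(Ω) there exists c ∈ ℝ with ( ∫₀^1 ( s^{1/p − 1} [ (f − c)**(s) − (f − c)*(s) ] )^q ds )^{1/q} ≤ C ( ∫_Ω |∇f(x)|^q dx )^{1/q}. -/

import Mathlib

open MeasureTheory Set
open scoped ENNReal NNReal

noncomputable section

/-- The decreasing rearrangement of `u` with respect to the measure `μ`: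
`u*(t) = inf { λ ≥ 0 : μ{|u| > λ} ≤ t }`. -/
def decRearr {α : Type*} [MeasurableSpace α] (μ : Measure α) (u : α → ℝ) (t : ℝ) : ℝ :=
  sInf {l : ℝ | 0 ≤ l ∧ μ {x | l < |u x|} ≤ ENNReal.ofReal t}

/-- `u**(t) = (1/t) ∫₀ᵗ u*(s) ds`. -/
def decRearrAvg {α : Type*} [MeasurableSpace α] (μ : Measure α) (u : α → ℝ) (t : ℝ) : ℝ :=
  (1 / t) * ∫ s in Ioc (0 : ℝ) t, decRearr μ u s

abbrev Euc (n : ℕ) := EuclideanSpace ℝ (Fin n)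

/-- `|∇f|(x)`, using the a.e. defined differential (Rademacher's theorem for
locally Lipschitz functions). -/
def gradNorm {n : ℕ} (f : Euc n → ℝ) (x : Euc n) : ℝ := ‖fderiv ℝ f x‖

/-- The admissible class `W(Ω)`: locally Lipschitz on `Ω`, with `f` and `|∇f|`
integrable on `Ω`. -/
def MemW {n : ℕ} (Ω : Set (Euc n)) (f : Euc n → ℝ) : Prop :=
  (∀ x ∈ Ω, ∃ s ∈ nhds x, ∃ K : ℝ≥0, LipschitzOnWith K f s) ∧
    IntegrableOn f Ω ∧ IntegrableOn (gradNorm f) Ω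

/-- `Ω` satisfies the `p`-Sobolev–Poincaré inequality with constant `C₀`. -/
def SPIneq {n : ℕ} (Ω : Set (Euc n)) (p C₀ : ℝ) : Prop :=
  ∀ f : Euc n → ℝ, MemW Ω f →
    (∫ x in Ω, |f x - ∫ y in Ω, f y| ^ p) ^ (1 / p) ≤ C₀ * ∫ x in Ω, gradNorm f x

/-- `r` is a median of `f` on `Ω` (with `|Ω| = 1`). -/
def IsMedian {n : ℕ} (Ω : Set (Euc n)) (f : Euc n → ℝ) (r : ℝ) : Prop :=
  1 / 2 ≤ volume {x ∈ Ω | r ≤ f x} ∧ 1 / 2 ≤ volume {x ∈ Ω | f x ≤ r}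


lemma s6_holder {α : Type*} [MeasurableSpace α] (ν : Measure α) {q : ℝ} (hq : 1 ≤ q)
    {u : α → ℝ≥0∞} (hu : AEMeasurable u ν) :
    ∫⁻ x, u x ∂ν ≤ (∫⁻ x, u x ^ q ∂ν) ^ (1 / q) * ν univ ^ (1 - 1 / q) := by
  rcases hq.eq_or_lt with rfl | hq
  · simp
  · have hc : q.HolderConjugate (q.conjExponent) := Real.HolderConjugate.conjExponent hq
    have := ENNReal.lintegral_mul_le_Lp_mul_Lq ν hc hu (aemeasurable_const (b := (1 : ℝ≥0∞)))
    have h2 : 1 / q.conjExponent = 1 - 1 / q := by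
      have := hc.inv_add_inv_eq_one
      simp only [one_div]; linarith
    simpa [h2] using this

lemma s6_young (r : ℝ≥0∞) (b : ℕ → ℝ≥0∞) {q : ℝ} (hq : 1 ≤ q) :
    ∑' k, (∑' m, r ^ m * b (k + m)) ^ q ≤ (∑' m, r ^ m) ^ q * ∑' j, b j ^ q := by
  have hq0 : 0 < q := by linarith
  set R : ℝ≥0∞ := ∑' m, r ^ m with hR
  let ν : Measure ℕ := Measure.sum (fun m => r ^ m • Measure.dirac m)
  have hν : ∀ u : ℕ → ℝ≥0∞, ∫⁻ x, u x ∂ν = ∑' m, r ^ m * u m := by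
    intro u
    simp [ν, lintegral_sum_measure, lintegral_smul_measure]
  have hνu : ν univ = R := by
    have := hν (fun _ => 1)
    rw [lintegral_one] at this
    rw [this, hR]; simp only [mul_one]
  have h1 : ∀ k, (∑' m, r ^ m * b (k + m)) ^ q
      ≤ R ^ (q - 1) * ∑' m, r ^ m * b (k + m) ^ q := by
    intro k
    have := s6_holder ν hq (u := fun m => b (k + m)) (Measurable.of_discrete.aemeasurable)
    rw [hν, hν, hνu] at this
    calc _ ≤ _ := ENNReal.rpow_le_rpow this hq0.le
      _ = _ := by
        rw [ENNReal.mul_rpow_of_nonneg _ _ hq0.le, ← ENNReal.rpow_mul, ← ENNReal.rpow_mul,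
          one_div_mul_cancel hq0.ne', ENNReal.rpow_one, mul_comm]
        congr 2
        field_simp
  calc _ ≤ ∑' k, R ^ (q - 1) * ∑' m, r ^ m * b (k + m) ^ q := ENNReal.tsum_le_tsum h1
    _ = R ^ (q - 1) * ∑' m, r ^ m * ∑' k, b (k + m) ^ q := by
      rw [ENNReal.tsum_mul_left, ENNReal.tsum_comm]
      simp_rw [ENNReal.tsum_mul_left]
    _ ≤ R ^ (q - 1) * ∑' m, r ^ m * ∑' k, b k ^ q := by
      refine mul_le_mul_right (ENNReal.tsum_le_tsum fun m => mul_le_mul_right ?_ _) _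
      exact ENNReal.tsum_comp_le_tsum_of_injective (add_left_injective m) (fun k => b k ^ q)
    _ = R ^ (q - 1) * R * ∑' j, b j ^ q := by
      rw [ENNReal.tsum_mul_right, mul_assoc]
    _ ≤ _ := by
      gcongr
      nth_rewrite 2 [← ENNReal.rpow_one R]
      rw [← ENNReal.rpow_add_of_nonneg _ _ (by linarith) (by norm_num)]
      simp

section rearr
variable {α : Type*} [MeasurableSpace α] {μ : Measure α} {u : α → ℝ}

lemma s6_dr_nonneg (t : ℝ) : 0 ≤ decRearr μ u t := Real.sInf_nonneg (fun _ h => h.1)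

lemma s6_dr_le {t l : ℝ} (hl : 0 ≤ l) (h : μ {x | l < |u x|} ≤ ENNReal.ofReal t) :
    decRearr μ u t ≤ l := csInf_le ⟨0, fun _ h => h.1⟩ ⟨hl, h⟩

lemma s6_dr_nonempty (hu : Integrable u μ) {t : ℝ} (ht : 0 < t) :
    {l : ℝ | 0 ≤ l ∧ μ {x | l < |u x|} ≤ ENNReal.ofReal t}.Nonempty := by
  set M := ∫⁻ x, ‖u x‖ₑ ∂μ
  have hM : M ≠ ⊤ := hu.2.ne
  refine ⟨(M.toReal + 1) / t, by positivity, ?_⟩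
  have h := mul_meas_ge_le_lintegral₀ hu.1.enorm (ENNReal.ofReal ((M.toReal + 1) / t))
  have hsub : {x | (M.toReal + 1) / t < |u x|} ⊆
      {x | ENNReal.ofReal ((M.toReal + 1) / t) ≤ ‖u x‖ₑ} := by
    intro x hx
    simp only [mem_ofPred_eq] at hx ⊢
    rw [Real.enorm_eq_ofReal_abs]
    exact ENNReal.ofReal_le_ofReal hx.le
  have hpos : 0 < (M.toReal + 1) / t := by positivity
  have h2 : ENNReal.ofReal ((M.toReal + 1) / t) * μ {x | (M.toReal + 1) / t < |u x|} ≤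
      ENNReal.ofReal ((M.toReal + 1) / t) * ENNReal.ofReal t := by
    calc _ ≤ _ := by gcongr
      _ ≤ M := h
      _ = ENNReal.ofReal M.toReal := (ENNReal.ofReal_toReal hM).symm
      _ ≤ _ := by
        rw [← ENNReal.ofReal_mul hpos.le]
        apply ENNReal.ofReal_le_ofReal
        rw [div_mul_cancel₀ _ ht.ne']; linarith
  exact (ENNReal.mul_le_mul_iff_right (by simpa using hpos) (by simp)).1 h2

lemma s6_dr_meas (hu : Integrable u μ) {t : ℝ} (ht : 0 < t) :
    μ {x | decRearr μ u t < |u x|} ≤ ENNReal.ofReal t := by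
  have : {x | decRearr μ u t < |u x|} =
      ⋃ n : ℕ, {x | decRearr μ u t + 1 / ((n : ℝ) + 1) < |u x|} := by
    ext x
    simp only [mem_ofPred_eq, mem_iUnion]
    constructor
    · intro h
      obtain ⟨n, hn⟩ := exists_nat_one_div_lt (sub_pos.2 h)
      exact ⟨n, by linarith⟩
    · rintro ⟨n, hn⟩
      have : 0 < 1 / ((n : ℝ) + 1) := by positivity
      linarith
  rw [this, Monotone.measure_iUnion]
  · refine iSup_le fun n => ?_
    have hlt : decRearr μ u t < decRearr μ u t + 1 / ((n : ℝ) + 1) := by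
      have : 0 < 1 / ((n : ℝ) + 1) := by positivity
      linarith
    obtain ⟨l, hl, hl2⟩ := exists_lt_of_csInf_lt (s6_dr_nonempty hu ht) hlt
    refine le_trans (measure_mono ?_) hl.2
    intro x hx
    exact hl2.trans hx
  · intro n m hnm x hx
    simp only [mem_ofPred_eq] at hx ⊢
    have : 1 / ((m : ℝ) + 1) ≤ 1 / ((n : ℝ) + 1) := Nat.one_div_le_one_div hnm
    linarith

lemma s6_dr_anti (hu : Integrable u μ) {s t : ℝ} (hs : 0 < s) (hst : s ≤ t) :
    decRearr μ u t ≤ decRearr μ u s :=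
  s6_dr_le (s6_dr_nonneg s) ((s6_dr_meas hu hs).trans (ENNReal.ofReal_le_ofReal hst))

lemma s6_dr_lint (hu : Integrable u μ) {s : ℝ} (hs : 0 < s) :
    ∫⁻ v in Ioc 0 s, ENNReal.ofReal (decRearr μ u v - decRearr μ u s) ≤
      ∫⁻ x, ENNReal.ofReal (|u x| - decRearr μ u s) ∂μ := by
  set d := decRearr μ u s with hd
  have hanti : AntitoneOn (decRearr μ u) (Ioc 0 s) := fun a ha b hb hab => s6_dr_anti hu ha.1 hab
  have hm : AEMeasurable (fun v => decRearr μ u v - d) (volume.restrict (Ioc 0 s)) :=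
    (aemeasurable_restrict_of_antitoneOn measurableSet_Ioc hanti).sub_const d
  rw [lintegral_eq_lintegral_meas_lt _ _ hm]
  · have h2 : ∫⁻ x, ENNReal.ofReal (|u x| - d) ∂μ
        = ∫⁻ x, ENNReal.ofReal (max (|u x| - d) 0) ∂μ := by
      congr 1; ext x; simp [ENNReal.ofReal_max]
    rw [h2, lintegral_eq_lintegral_meas_lt]
    · apply setLIntegral_mono' measurableSet_Ioi
      intro l hl
      rw [Measure.restrict_apply' measurableSet_Ioc]
      have hset : {a | l < max (|u a| - d) 0} = {a | l + d < |u a|} := by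
        ext a
        have : (0 : ℝ) < l := hl
        simp only [mem_ofPred_eq, lt_max_iff]
        constructor
        · rintro (h | h) <;> linarith
        · intro h; left; linarith
      rw [hset]
      rcases eq_or_ne (μ {a | l + d < |u a|}) ⊤ with htop | htop
      · rw [htop]; exact le_top
      calc _ ≤ volume (Ioo 0 (μ {a | l + d < |u a|}).toReal) := by
            apply measure_mono
            rintro v ⟨hv1, hv2⟩
            refine ⟨hv2.1, ?_⟩
            by_contra hcon
            push Not at hcon
            have : decRearr μ u v ≤ l + d := by
              apply s6_dr_le (add_nonneg (le_of_lt hl) (s6_dr_nonneg s))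
              rw [← ENNReal.ofReal_toReal htop]
              exact ENNReal.ofReal_le_ofReal hcon
            simp only [mem_ofPred_eq] at hv1
            linarith
        _ = _ := by simp [htop]
    · exact Filter.Eventually.of_forall fun x => le_max_right _ _
    · exact ((hu.1.aemeasurable.abs).sub_const d).max aemeasurable_const
  · filter_upwards [ae_restrict_mem measurableSet_Ioc] with v hv
    simpa using s6_dr_anti hu hv.1 hv.2

lemma s6_dr_diff (hu : Integrable u μ) [IsFiniteMeasure μ] {s : ℝ} (hs : 0 < s) :
    ‖decRearrAvg μ u s - decRearr μ u s‖ₑ ≤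
      ENNReal.ofReal (1 / s) * ∫⁻ x, ENNReal.ofReal (|u x| - decRearr μ u s) ∂μ := by
  have hl := s6_dr_lint hu hs
  set d := decRearr μ u s with hd
  have hanti : AntitoneOn (decRearr μ u) (Ioc 0 s) := fun a ha b hb hab => s6_dr_anti hu ha.1 hab
  have hm : AEMeasurable (fun v => decRearr μ u v - d) (volume.restrict (Ioc 0 s)) :=
    (aemeasurable_restrict_of_antitoneOn measurableSet_Ioc hanti).sub_const d
  have heq : ∫⁻ v in Ioc 0 s, ‖decRearr μ u v - d‖ₑ =
      ∫⁻ v in Ioc 0 s, ENNReal.ofReal (decRearr μ u v - d) := by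
    apply setLIntegral_congr_fun measurableSet_Ioc
    intro v hv
    simp only
    rw [Real.enorm_eq_ofReal]
    simpa using s6_dr_anti hu hv.1 hv.2
  have hfin : ∫⁻ x, ENNReal.ofReal (|u x| - d) ∂μ < ⊤ := by
    calc _ ≤ ∫⁻ x, ‖u x‖ₑ ∂μ := by
          apply lintegral_mono
          intro x
          simp only
          rw [Real.enorm_eq_ofReal_abs]
          exact ENNReal.ofReal_le_ofReal (by linarith [s6_dr_nonneg (μ := μ) (u := u) s])
      _ < ⊤ := hu.2
  have hint : IntegrableOn (fun v => decRearr μ u v - d) (Ioc 0 s) :=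
    ⟨hm.aestronglyMeasurable, by
      rw [HasFiniteIntegral, heq]; exact hl.trans_lt hfin⟩
  have hint2 : IntegrableOn (fun v => decRearr μ u v) (Ioc 0 s) := by
    have := hint.add (integrableOn_const (C := d) (s := Ioc 0 s) (μ := volume) (by simp))
    refine this.congr_fun (fun v _ => by simp) measurableSet_Ioc
  have hval : decRearrAvg μ u s - d = (1 / s) * ∫ v in Ioc 0 s, (decRearr μ u v - d) := by
    rw [integral_sub hint2 (integrableOn_const (by simp))]
    simp [decRearrAvg, hs.le]
    field_simp
  rw [hval, enorm_mul, Real.enorm_eq_ofReal (by positivity)]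
  gcongr
  exact (enorm_integral_le_lintegral_enorm _).trans (heq.le.trans hl)

lemma s6_median [IsProbabilityMeasure μ] (hu : Integrable u μ) :
    ∃ c : ℝ, μ {x | c < u x} ≤ 1 / 2 ∧ μ {x | u x < c} ≤ 1 / 2 := by
  obtain ⟨l, hl0, hl⟩ := s6_dr_nonempty hu (t := 1 / 4) (by norm_num)
  have h14 : ENNReal.ofReal (1 / 4) ≤ 1 / 2 := by
    rw [ENNReal.ofReal_le_iff_le_toReal (by simp)]; norm_num
  set S : Set ℝ := {r | μ {x | r < u x} ≤ 1 / 2} with hS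
  have hne : S.Nonempty := by
    refine ⟨l, le_trans (measure_mono ?_) (hl.trans h14)⟩
    intro x hx
    have hx2 : l < u x := hx
    exact lt_of_lt_of_le hx2 (le_abs_self _)
  have hbd : BddBelow S := by
    refine ⟨-l, fun r hr => ?_⟩
    by_contra hcon
    push Not at hcon
    have h1 : (univ : Set α) ⊆ {x | l < |u x|} ∪ {x | r < u x} := by
      intro x _
      by_cases h : l < |u x|
      · left; exact h
      · right
        push Not at h
        have := (abs_le.1 h).1
        exact lt_of_lt_of_le hcon this
    have h2 : (1 : ℝ≥0∞) ≤ ENNReal.ofReal (1 / 4) + 1 / 2 := by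
      calc 1 = μ univ := by simp
        _ ≤ _ := measure_mono h1
        _ ≤ _ := measure_union_le _ _
        _ ≤ _ := add_le_add hl hr
    have h3 : (1 / 2 : ℝ≥0∞) = ENNReal.ofReal (1 / 2) := by
      rw [ENNReal.ofReal_div_of_pos (by norm_num)]; simp
    rw [h3, ← ENNReal.ofReal_add (by norm_num) (by norm_num), ENNReal.one_le_ofReal] at h2
    norm_num at h2
  refine ⟨sInf S, ?_, ?_⟩
  · have : {x | sInf S < u x} = ⋃ n : ℕ, {x | sInf S + 1 / ((n : ℝ) + 1) < u x} := by
      ext x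
      simp only [mem_ofPred_eq, mem_iUnion]
      constructor
      · intro h
        obtain ⟨n, hn⟩ := exists_nat_one_div_lt (sub_pos.2 h)
        exact ⟨n, by linarith⟩
      · rintro ⟨n, hn⟩
        have : 0 < 1 / ((n : ℝ) + 1) := by positivity
        linarith
    rw [this, Monotone.measure_iUnion]
    · refine iSup_le fun n => ?_
      have hlt : sInf S < sInf S + 1 / ((n : ℝ) + 1) := by
        have : 0 < 1 / ((n : ℝ) + 1) := by positivity
        linarith
      obtain ⟨r, hr, hr2⟩ := exists_lt_of_csInf_lt hne hlt
      refine le_trans (measure_mono ?_) hr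
      intro x hx
      exact hr2.trans hx
    · intro n m hnm x hx
      simp only [mem_ofPred_eq] at hx ⊢
      have : 1 / ((m : ℝ) + 1) ≤ 1 / ((n : ℝ) + 1) := Nat.one_div_le_one_div hnm
      linarith
  · have : {x | u x < sInf S} = ⋃ n : ℕ, {x | sInf S - 1 / ((n : ℝ) + 1) < u x}ᶜ := by
      ext x
      simp only [mem_ofPred_eq, mem_iUnion, mem_compl_iff, not_lt]
      constructor
      · intro h
        obtain ⟨n, hn⟩ := exists_nat_one_div_lt (sub_pos.2 h)
        exact ⟨n, by linarith⟩
      · rintro ⟨n, hn⟩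
        have : 0 < 1 / ((n : ℝ) + 1) := by positivity
        linarith
    rw [this, Monotone.measure_iUnion]
    · refine iSup_le fun n => ?_
      have hlt : sInf S - 1 / ((n : ℝ) + 1) < sInf S := by
        have : 0 < 1 / ((n : ℝ) + 1) := by positivity
        linarith
      have hr := notMem_of_lt_csInf hlt hbd
      rw [prob_compl_eq_one_sub₀ (nullMeasurableSet_lt aemeasurable_const hu.1.aemeasurable)]
      have hr' : 1 / 2 ≤ μ {x | sInf S - 1 / ((n : ℝ) + 1) < u x} := le_of_not_ge hr
      rw [tsub_le_iff_right]
      calc (1 : ℝ≥0∞) = 1 / 2 + 1 / 2 := (ENNReal.add_halves 1).symm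
        _ ≤ _ := by gcongr
    · intro n m hnm x hx
      simp only [mem_ofPred_eq, mem_compl_iff, not_lt] at hx ⊢
      have : 1 / ((m : ℝ) + 1) ≤ 1 / ((n : ℝ) + 1) := Nat.one_div_le_one_div hnm
      linarith

lemma s6_telescope (l : ℕ → ℝ) (hl : Monotone l) (y : ℝ) (k : ℕ) (hy : ∃ N, y ≤ l N) :
    ENNReal.ofReal (y - l k) ≤
      ∑' m, ENNReal.ofReal (min y (l (k + m + 1)) - l (k + m)) := by
  have h : ∀ N, ENNReal.ofReal (min y (l (k + N)) - l k) ≤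
      ∑ m ∈ Finset.range N, ENNReal.ofReal (min y (l (k + m + 1)) - l (k + m)) := by
    intro N
    induction N with
    | zero => simp
    | succ N ih =>
      rw [Finset.sum_range_succ]
      refine le_trans ?_ (add_le_add_left ih _)
      rcases le_total y (l (k + N)) with h | h
      · rw [min_eq_left h, min_eq_left (h.trans (hl (by omega)))]
        exact le_self_add
      · refine le_trans (ENNReal.ofReal_le_ofReal ?_) ENNReal.ofReal_add_le
        rw [min_eq_right h, ← add_assoc]; linarith
  obtain ⟨N, hN⟩ := hy
  have h1 := h N
  rw [min_eq_left (hN.trans (hl (by omega)))] at h1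
  exact h1.trans (ENNReal.sum_le_tsum _)

end rearr

lemma s6_memW_cont {n : ℕ} {Ω : Set (Euc n)} {g : Euc n → ℝ} (hg : MemW Ω g)
    {x : Euc n} (hx : x ∈ Ω) : ContinuousAt g x := by
  obtain ⟨s, hs, K, hK⟩ := hg.1 x hx
  exact hK.continuousOn.continuousAt hs

lemma s6_gradNorm_meas {n : ℕ} (g : Euc n → ℝ) : Measurable (gradNorm g) :=
  (measurable_fderiv ℝ g).norm

lemma s6_memW_neg {n : ℕ} {Ω : Set (Euc n)} {g : Euc n → ℝ} (hg : MemW Ω g) :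
    MemW Ω (fun x => - g x) ∧ gradNorm (fun x => - g x) = gradNorm g := by
  have h : gradNorm (fun x => - g x) = gradNorm g := by
    ext x
    simp only [gradNorm]
    rw [fderiv_fun_neg, norm_neg]
  refine ⟨⟨?_, hg.2.1.neg, h ▸ hg.2.2⟩, h⟩
  intro x hx
  obtain ⟨s, hs, K, hK⟩ := hg.1 x hx
  exact ⟨s, hs, K, hK.neg⟩

lemma s6_memW_sub {n : ℕ} {Ω : Set (Euc n)} {g : Euc n → ℝ} (hg : MemW Ω g)
    (hv : volume Ω = 1) (c : ℝ) :
    MemW Ω (fun x => g x - c) ∧ gradNorm (fun x => g x - c) = gradNorm g := by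
  have h : gradNorm (fun x => g x - c) = gradNorm g := by
    ext x
    simp only [gradNorm]
    rw [fderiv_sub_const]
  refine ⟨⟨?_, hg.2.1.sub (integrableOn_const (by simp [hv])), h ▸ hg.2.2⟩, h⟩
  intro x hx
  obtain ⟨s, hs, K, hK⟩ := hg.1 x hx
  refine ⟨s, hs, K, ?_⟩
  intro y hy z hz
  simpa [edist_dist, dist_eq_norm] using hK hy hz

lemma s6_trunc_pos {n : ℕ} {Ω : Set (Euc n)} (ho : IsOpen Ω) (hv : volume Ω = 1)
    {p C₀ : ℝ} (hp : 1 < p) (hC₀ : 0 < C₀) (hSP : SPIneq Ω p C₀) {g : Euc n → ℝ}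
    (hg : MemW Ω g) {a b : ℝ} (hab : a ≤ b)
    (hhalf : volume.restrict Ω {x | a < g x} ≤ 1 / 2) :
    ∫⁻ x in Ω, ENNReal.ofReal (min (g x) b - a) ≤
      ENNReal.ofReal (2 * C₀) * volume.restrict Ω {x | a < g x} ^ (1 - 1 / p) *
        ∫⁻ x in {x | a < g x ∧ g x < b}, ENNReal.ofReal (gradNorm g x) ∂(volume.restrict Ω) := by
  set μ := volume.restrict Ω with hμ
  have : IsProbabilityMeasure μ := ⟨by simp [hμ, hv]⟩
  have hgm : AEMeasurable g μ := hg.2.1.1.aemeasurable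
  set h : Euc n → ℝ := fun x => max (min (g x) b - a) 0 with hh
  have hp0 : 0 < p := by linarith
  have hba : 0 ≤ b - a := by linarith
  have h0 : ∀ x, 0 ≤ h x := fun x => le_max_right _ _
  have h1 : ∀ x, h x ≤ b - a := fun x => max_le (by linarith [min_le_right (g x) b]) hba
  have hhm : AEMeasurable h μ := ((hgm.min aemeasurable_const).sub_const a).max aemeasurable_const
  set S : Set (Euc n) := {x | a < g x ∧ g x < b} with hS
  have hSm : NullMeasurableSet S μ :=
    (nullMeasurableSet_lt aemeasurable_const hgm).inter
      (nullMeasurableSet_lt hgm aemeasurable_const)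
  set A : Set (Euc n) := {x | a < g x} with hA
  -- gradient
  have hgrad : ∀ x ∈ Ω, gradNorm h x = S.indicator (gradNorm g) x := by
    intro x hx
    have hc := s6_memW_cont hg hx
    by_cases hxS : x ∈ S
    · rw [indicator_of_mem hxS]
      have : h =ᶠ[nhds x] fun y => g y - a := by
        filter_upwards [hc.eventually (lt_mem_nhds hxS.1), hc.eventually (gt_mem_nhds hxS.2)]
          with y hy1 hy2
        simp only [hh]
        rw [min_eq_left hy2.le, max_eq_left (by linarith)]
      simp only [gradNorm]
      rw [this.fderiv_eq, fderiv_sub_const]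
    · rw [indicator_of_notMem hxS]
      have : fderiv ℝ h x = 0 := by
        by_cases hax : a < g x
        · have hbx : b ≤ g x := by
            by_contra hcon
            exact hxS ⟨hax, not_le.1 hcon⟩
          apply IsLocalMax.fderiv_eq_zero
          refine Filter.Eventually.of_forall fun y => ?_
          have : h x = b - a := by
            simp only [hh]; rw [min_eq_right hbx, max_eq_left hba]
          rw [this]; exact h1 y
        · apply IsLocalMin.fderiv_eq_zero
          refine Filter.Eventually.of_forall fun y => ?_
          have : h x = 0 := by
            simp only [hh]
            apply max_eq_right
            linarith [min_le_left (g x) b]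
          rw [this]; exact h0 y
      simp [gradNorm, this]
  have hhint : Integrable h μ := by
    refine Integrable.of_bound hhm.aestronglyMeasurable (b - a) ?_
    filter_upwards with x
    rw [Real.norm_of_nonneg (h0 x)]; exact h1 x
  have hhW : MemW Ω h := by
    refine ⟨?_, hhint, ?_⟩
    · intro x hx
      obtain ⟨s, hs, K, hK⟩ := hg.1 x hx
      refine ⟨s, hs, K, ?_⟩
      refine LipschitzOnWith.of_dist_le_mul fun y hy z hz => ?_
      refine le_trans ?_ (hK.dist_le_mul y hy z hz)
      simp only [hh, Real.dist_eq]
      calc _ ≤ |(min (g y) b - a) - (min (g z) b - a)| := abs_max_sub_max_le_abs _ _ _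
        _ = |min (g y) b - min (g z) b| := by congr 1; ring
        _ ≤ max |g y - g z| |b - b| := abs_min_sub_min_le_max _ _ _ _
        _ = _ := by simp
    · refine Integrable.mono hg.2.2 (s6_gradNorm_meas h).aestronglyMeasurable ?_
      filter_upwards [ae_restrict_mem ho.measurableSet] with x hx
      rw [hgrad x hx]
      exact norm_indicator_le_norm_self _ _
  have hsp := hSP h hhW
  set m := ∫ y, h y ∂μ with hm
  have hlint : ∫⁻ x, ENNReal.ofReal (min (g x) b - a) ∂μ = ENNReal.ofReal m := by
    rw [hm, ofReal_integral_eq_lintegral_ofReal hhint (Filter.Eventually.of_forall h0)]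
    congr 1; ext x; simp [hh, ENNReal.ofReal_max]
  have hm0 : 0 ≤ m := integral_nonneg h0
  have hgl : ENNReal.ofReal (∫ x, gradNorm h x ∂μ) =
      ∫⁻ x in S, ENNReal.ofReal (gradNorm g x) ∂μ := by
    rw [ofReal_integral_eq_lintegral_ofReal hhW.2.2
      (Filter.Eventually.of_forall fun x => norm_nonneg _), ← lintegral_indicator₀ hSm]
    apply setLIntegral_congr_fun ho.measurableSet
    intro x hx
    simp only
    rw [hgrad x hx]
    by_cases hxS : x ∈ S <;> simp [hxS]
  -- half
  have hmA : m = ∫ x in A, h x ∂μ := by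
    rw [setIntegral_eq_integral_of_forall_compl_eq_zero]
    intro x hx
    have : g x ≤ a := not_lt.1 hx
    simp only [hh]
    apply max_eq_right
    linarith [min_le_left (g x) b]
  have hAr : μ.real A ≤ 1 / 2 := by
    have := ENNReal.toReal_mono (by simp) hhalf
    simpa [Measure.real] using this
  have hkey : m ≤ 2 * ∫ x in A, |h x - m| ∂μ := by
    have e1 : ∫ x in A, (h x - m) ∂μ = m - μ.real A * m := by
      rw [integral_sub hhint.integrableOn (integrableOn_const (by simp)), ← hmA]
      simp
    have e2 : ∫ x in A, (h x - m) ∂μ ≤ ∫ x in A, |h x - m| ∂μ :=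
      (le_abs_self _).trans (abs_integral_le_integral_abs)
    nlinarith
  have hbd : ∀ x, |h x - m| ≤ (b - a) + m := fun x => by
    rw [abs_le]; constructor <;> linarith [h0 x, h1 x]
  have hpint : Integrable (fun x => |h x - m| ^ p) μ := by
    refine Integrable.of_bound ((hhm.sub_const m).abs.pow_const p).aestronglyMeasurable
      (((b - a) + m) ^ p) ?_
    filter_upwards with x
    rw [Real.norm_of_nonneg (by positivity)]
    exact Real.rpow_le_rpow (abs_nonneg _) (hbd x) hp0.le
  have hH : ENNReal.ofReal (∫ x in A, |h x - m| ∂μ) ≤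
      ENNReal.ofReal (C₀ * ∫ x, gradNorm h x ∂μ) * μ A ^ (1 - 1 / p) := by
    have hii : Integrable (fun x => |h x - m|) μ := (hhint.sub (integrable_const m)).abs
    rw [ofReal_integral_eq_lintegral_ofReal hii.integrableOn
      (Filter.Eventually.of_forall fun x => abs_nonneg _)]
    refine (s6_holder (μ.restrict A) hp.le
      ((hhm.sub_const m).abs.ennreal_ofReal.restrict)).trans ?_
    rw [Measure.restrict_apply_univ]
    gcongr
    calc _ ≤ (∫⁻ x, ENNReal.ofReal |h x - m| ^ p ∂μ) ^ (1 / p) := by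
          gcongr
          exact Measure.restrict_le_self
      _ = ENNReal.ofReal ((∫ x, |h x - m| ^ p ∂μ) ^ (1 / p)) := by
          rw [← ENNReal.ofReal_rpow_of_nonneg (integral_nonneg fun x => by positivity)
            (by positivity), ofReal_integral_eq_lintegral_ofReal hpint
            (Filter.Eventually.of_forall fun x => by positivity)]
          congr 2; ext x
          rw [ENNReal.ofReal_rpow_of_nonneg (abs_nonneg _) hp0.le]
      _ ≤ _ := ENNReal.ofReal_le_ofReal hsp
  rw [hlint]
  calc ENNReal.ofReal m ≤ ENNReal.ofReal (2 * ∫ x in A, |h x - m| ∂μ) :=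
        ENNReal.ofReal_le_ofReal hkey
    _ = ENNReal.ofReal 2 * ENNReal.ofReal (∫ x in A, |h x - m| ∂μ) :=
        ENNReal.ofReal_mul (by norm_num)
    _ ≤ ENNReal.ofReal 2 * (ENNReal.ofReal (C₀ * ∫ x, gradNorm h x ∂μ) * μ A ^ (1 - 1 / p)) := by
        gcongr
    _ = _ := by
        rw [ENNReal.ofReal_mul hC₀.le, ENNReal.ofReal_mul (by norm_num), hgl]
        ring

lemma s6_trunc {n : ℕ} {Ω : Set (Euc n)} (ho : IsOpen Ω) (hv : volume Ω = 1)
    {p C₀ : ℝ} (hp : 1 < p) (hC₀ : 0 < C₀) (hSP : SPIneq Ω p C₀) {g : Euc n → ℝ}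
    (hg : MemW Ω g) {a b : ℝ} (ha : 0 ≤ a) (hab : a ≤ b)
    (hh1 : volume.restrict Ω {x | 0 < g x} ≤ 1 / 2)
    (hh2 : volume.restrict Ω {x | g x < 0} ≤ 1 / 2) {M : ℝ≥0∞}
    (hM : volume.restrict Ω {x | a < |g x|} ≤ M) :
    ∫⁻ x in Ω, ENNReal.ofReal (min |g x| b - a) ≤
      ENNReal.ofReal (2 * C₀) * M ^ (1 - 1 / p) *
        ∫⁻ x in {x | a < |g x| ∧ |g x| < b}, ENNReal.ofReal (gradNorm g x)
          ∂(volume.restrict Ω) := by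
  obtain ⟨hn, hng⟩ := s6_memW_neg hg
  set μ := volume.restrict Ω with hμ
  have hgm : AEMeasurable g μ := hg.2.1.1.aemeasurable
  have hq : 0 ≤ 1 - 1 / p := by
    rw [sub_nonneg, div_le_one (by linarith)]; exact hp.le
  have e1 := s6_trunc_pos ho hv hp hC₀ hSP hg hab ((measure_mono (fun x hx => by
    have hx2 : a < g x := hx
    exact lt_of_le_of_lt ha hx2)).trans hh1)
  have e2 := s6_trunc_pos ho hv hp hC₀ hSP hn hab ((measure_mono (fun x hx => by
    have hx2 : a < - g x := hx
    show g x < 0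
    linarith)).trans hh2)
  rw [hng] at e2
  have m1 : μ {x | a < g x} ≤ M := (measure_mono (fun x hx => by
    have hx2 : a < g x := hx
    exact lt_of_lt_of_le hx2 (le_abs_self _))).trans hM
  have m2 : μ {x | a < - g x} ≤ M := (measure_mono (fun x hx => by
    have hx2 : a < - g x := hx
    exact lt_of_lt_of_le hx2 (neg_le_abs _))).trans hM
  set S1 := {x | a < g x ∧ g x < b}
  set S2 := {x | a < - g x ∧ - g x < b}
  have hS2 : NullMeasurableSet S2 μ :=
    (nullMeasurableSet_lt aemeasurable_const hgm.neg).inter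
      (nullMeasurableSet_lt hgm.neg aemeasurable_const)
  have hdis : Disjoint S1 S2 := by
    rw [Set.disjoint_left]
    rintro x ⟨h1, _⟩ ⟨h2, _⟩
    linarith
  have hsub : S1 ∪ S2 ⊆ {x | a < |g x| ∧ |g x| < b} := by
    rintro x (⟨h1, h2⟩ | ⟨h1, h2⟩)
    · show _ ∧ _
      rw [abs_of_pos (by linarith)]; exact ⟨h1, h2⟩
    · show _ ∧ _
      rw [abs_of_neg (by linarith)]; exact ⟨h1, h2⟩
  calc ∫⁻ x, ENNReal.ofReal (min |g x| b - a) ∂μ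
      ≤ ∫⁻ x, (ENNReal.ofReal (min (g x) b - a) + ENNReal.ofReal (min (- g x) b - a)) ∂μ := by
        apply lintegral_mono
        intro x
        rcases abs_choice (g x) with h | h <;> simp only [h]
        · exact le_self_add
        · exact le_add_self
    _ = ∫⁻ x, ENNReal.ofReal (min (g x) b - a) ∂μ +
        ∫⁻ x, ENNReal.ofReal (min (- g x) b - a) ∂μ :=
        lintegral_add_left' ((hgm.min aemeasurable_const).sub_const a).ennreal_ofReal _
    _ ≤ _ := add_le_add e1 e2
    _ ≤ ENNReal.ofReal (2 * C₀) * M ^ (1 - 1 / p) *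
          (∫⁻ x in S1, ENNReal.ofReal (gradNorm g x) ∂μ) +
        ENNReal.ofReal (2 * C₀) * M ^ (1 - 1 / p) *
          (∫⁻ x in S2, ENNReal.ofReal (gradNorm g x) ∂μ) := by gcongr
    _ = ENNReal.ofReal (2 * C₀) * M ^ (1 - 1 / p) *
          (∫⁻ x in S1 ∪ S2, ENNReal.ofReal (gradNorm g x) ∂μ) := by
        rw [Measure.restrict_union₀ hdis.aedisjoint hS2, lintegral_add_measure, mul_add]
    _ ≤ _ := by
        gcongr

lemma s6_main {n : ℕ} {Ω : Set (Euc n)} (ho : IsOpen Ω) (hv : volume Ω = 1)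
    {p C₀ q : ℝ} (hp : 1 < p) (hC₀ : 0 < C₀) (hq : 1 ≤ q) (hSP : SPIneq Ω p C₀) {g : Euc n → ℝ}
    (hg : MemW Ω g)
    (hh1 : volume.restrict Ω {x | 0 < g x} ≤ 1 / 2)
    (hh2 : volume.restrict Ω {x | g x < 0} ≤ 1 / 2) :
    ∫⁻ s in Ioc (0 : ℝ) 1, ‖(s ^ (1 / p - 1) * (decRearrAvg (volume.restrict Ω) g s
                  - decRearr (volume.restrict Ω) g s)) ^ q‖ₑ ≤
    ENNReal.ofReal (8 * C₀ * (1 - (1 / 2 : ℝ) ^ (1 - 1 / p))⁻¹) ^ q *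
      ∫⁻ x in Ω, ENNReal.ofReal (gradNorm g x) ^ q := by
  set μ := volume.restrict Ω with hμ
  have : IsProbabilityMeasure μ := ⟨by simp [hμ, hv]⟩
  have hgm : AEMeasurable g μ := hg.2.1.1.aemeasurable
  have hgi : Integrable g μ := hg.2.1
  have hq0 : 0 < q := by linarith
  have hp0 : 0 < p := by linarith
  have hpinv : 0 < 1 - 1 / p := by
    rw [sub_pos, div_lt_one hp0]; exact hp
  have hpinv1 : 0 < 1 / p := by positivity
  have hqinv : 0 ≤ 1 - 1 / q := by
    rw [sub_nonneg, div_le_one hq0]; exact hq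
  have hqinv1 : 0 < 1 / q := by positivity
  set l : ℕ → ℝ := fun k => decRearr μ g ((1 / 2 : ℝ) ^ k) with hl
  have hhp : ∀ k : ℕ, (0 : ℝ) < (1 / 2 : ℝ) ^ k := fun k => by positivity
  have hlmono : Monotone l := by
    intro i j hij
    exact s6_dr_anti hgi (hhp j) (pow_le_pow_of_le_one (by norm_num) (by norm_num) hij)
  have hlmeas : ∀ k, μ {x | l k < |g x|} ≤ ENNReal.ofReal ((1 / 2 : ℝ) ^ k) :=
    fun k => s6_dr_meas hgi (hhp k)
  have hl0 : ∀ k, 0 ≤ l k := fun k => s6_dr_nonneg _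
  set A : ℕ → Set (Euc n) := fun j => {x | l j < |g x| ∧ |g x| < l (j + 1)} with hA
  have hAm : ∀ j, NullMeasurableSet (A j) μ := fun j =>
    (nullMeasurableSet_lt aemeasurable_const hgm.abs).inter
      (nullMeasurableSet_lt hgm.abs aemeasurable_const)
  set G : Euc n → ℝ≥0∞ := fun x => ENNReal.ofReal (gradNorm g x) with hG
  have hGm : Measurable G := (s6_gradNorm_meas g).ennreal_ofReal
  set b : ℕ → ℝ≥0∞ := fun j => (∫⁻ x in A j, G x ^ q ∂μ) ^ (1 / q) with hb
  have hbsum : ∑' j, b j ^ q ≤ ∫⁻ x, G x ^ q ∂μ := by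
    have hdis : Pairwise (Function.onFun Disjoint A) := by
      have key : ∀ i j, i < j → Disjoint (A i) (A j) := by
        intro i j hij
        rw [Set.disjoint_left]
        rintro x ⟨_, h1⟩ ⟨h2, _⟩
        have := hlmono (Nat.succ_le_of_lt hij)
        simp only [Nat.succ_eq_add_one] at this
        linarith
      intro i j hij
      rcases lt_or_gt_of_ne hij with h | h
      · exact key i j h
      · exact (key j i h).symm
    calc ∑' j, b j ^ q = ∑' j, ∫⁻ x in A j, G x ^ q ∂μ := by
          congr 1; ext j
          simp only [hb]
          rw [← ENNReal.rpow_mul, one_div_mul_cancel hq0.ne', ENNReal.rpow_one]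
      _ = ∫⁻ x in ⋃ j, A j, G x ^ q ∂μ :=
          (lintegral_iUnion₀ hAm (fun i j hij => (hdis hij).aedisjoint) _).symm
      _ ≤ _ := setLIntegral_le_lintegral _ _
  set Φ : ℕ → ℝ≥0∞ := fun k => ∫⁻ x, ENNReal.ofReal (|g x| - l k) ∂μ with hΦ
  set e : ℝ := (1 - 1 / p) + (1 - 1 / q) with he
  set θ : ℝ := (1 / 2 : ℝ) ^ e with hθ
  set r : ℝ := (1 / 2 : ℝ) ^ (1 - 1 / p) with hr
  have hθ0 : 0 < θ := by positivity
  have hr0 : 0 < r := by positivity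
  have hr1 : r < 1 := Real.rpow_lt_one (by norm_num) (by norm_num) hpinv
  have hθr : θ ≤ r := Real.rpow_le_rpow_of_exponent_ge (by norm_num) (by norm_num) (by linarith)
  have hθ4 : θ⁻¹ ≤ 4 := by
    have h4 : (1 / 4 : ℝ) ≤ θ := by
      calc (1 / 4 : ℝ) = (1 / 2 : ℝ) ^ (2 : ℝ) := by norm_num
        _ ≤ θ := Real.rpow_le_rpow_of_exponent_ge (by norm_num) (by norm_num) (by linarith)
    calc θ⁻¹ ≤ (1 / 4 : ℝ)⁻¹ := inv_anti₀ (by norm_num) h4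
      _ = 4 := by norm_num
  have hhalfpow : ∀ (k : ℕ) (z : ℝ), ((1 / 2 : ℝ) ^ k) ^ z = ((1 / 2 : ℝ) ^ z) ^ k := by
    intro k z
    rw [← Real.rpow_natCast, ← Real.rpow_natCast, ← Real.rpow_mul (by norm_num),
      ← Real.rpow_mul (by norm_num), mul_comm]
  -- one layer
  have hlayer : ∀ j, ∫⁻ x, ENNReal.ofReal (min |g x| (l (j + 1)) - l j) ∂μ ≤
      ENNReal.ofReal (2 * C₀) * (ENNReal.ofReal (θ ^ j) * b j) := by
    intro j
    have e1 := s6_trunc ho hv hp hC₀ hSP hg (hl0 j) (hlmono (Nat.le_succ j)) hh1 hh2 (hlmeas j)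
    refine e1.trans ?_
    have e2 := s6_holder (μ.restrict (A j)) hq (u := G) hGm.aemeasurable
    rw [Measure.restrict_apply_univ] at e2
    have e3 : μ (A j) ≤ ENNReal.ofReal ((1 / 2 : ℝ) ^ j) :=
      (measure_mono (fun x hx => hx.1)).trans (hlmeas j)
    calc _ ≤ ENNReal.ofReal (2 * C₀) * ENNReal.ofReal ((1 / 2) ^ j) ^ (1 - 1 / p) *
          (b j * ENNReal.ofReal ((1 / 2) ^ j) ^ (1 - 1 / q)) := by
            gcongr
            refine e2.trans ?_
            gcongr
      _ = ENNReal.ofReal (2 * C₀) * ((ENNReal.ofReal ((1 / 2) ^ j) ^ (1 - 1 / p) *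
          ENNReal.ofReal ((1 / 2) ^ j) ^ (1 - 1 / q)) * b j) := by ring
      _ = _ := by
          rw [← ENNReal.rpow_add_of_nonneg _ _ hpinv.le hqinv,
            ENNReal.ofReal_rpow_of_nonneg (hhp j).le (by positivity), hhalfpow]
  have hΦle : ∀ k, Φ k ≤ ∑' m, ENNReal.ofReal (2 * C₀) *
      (ENNReal.ofReal (θ ^ (k + m)) * b (k + m)) := by
    intro k
    calc Φ k ≤ ∫⁻ x, ∑' m, ENNReal.ofReal (min |g x| (l (k + m + 1)) - l (k + m)) ∂μ := by
          apply lintegral_mono_ae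
          have hnull : ∀ᵐ x ∂μ, ∃ N, |g x| ≤ l N := by
            rw [ae_iff]
            have : ∀ N, μ {x | ¬ ∃ N, |g x| ≤ l N} ≤ ENNReal.ofReal ((1 / 2 : ℝ) ^ N) := by
              intro N
              refine (measure_mono ?_).trans (hlmeas N)
              intro x hx
              simp only [mem_ofPred_eq, not_exists, not_le] at hx ⊢
              exact hx N
            have ht : Filter.Tendsto (fun N : ℕ => ENNReal.ofReal ((1 / 2 : ℝ) ^ N))
                Filter.atTop (nhds 0) := by
              have := ENNReal.tendsto_ofReal
                (tendsto_pow_atTop_nhds_zero_of_lt_one (r := (1 / 2 : ℝ)) (by norm_num)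
                  (by norm_num))
              simpa using this
            exact le_antisymm (ge_of_tendsto' ht this) bot_le
          filter_upwards [hnull] with x hx
          exact s6_telescope l hlmono _ k hx
      _ = ∑' m, ∫⁻ x, ENNReal.ofReal (min |g x| (l (k + m + 1)) - l (k + m)) ∂μ := by
          apply lintegral_tsum
          intro m
          exact ((hgm.abs.min aemeasurable_const).sub_const _).ennreal_ofReal
      _ ≤ _ := ENNReal.tsum_le_tsum fun m => hlayer (k + m)
  -- dyadic interval
  have hint : ∀ k : ℕ, ∫⁻ s in Ioc ((1 / 2 : ℝ) ^ (k + 1)) ((1 / 2 : ℝ) ^ k),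
      ‖(s ^ (1 / p - 1) * (decRearrAvg μ g s - decRearr μ g s)) ^ q‖ₑ ≤
      (ENNReal.ofReal ((θ ^ (k + 1))⁻¹) * Φ k) ^ q := by
    intro k
    have hpt : ∀ s ∈ Ioc ((1 / 2 : ℝ) ^ (k + 1)) ((1 / 2 : ℝ) ^ k),
        ‖(s ^ (1 / p - 1) * (decRearrAvg μ g s - decRearr μ g s)) ^ q‖ₑ ≤
        (ENNReal.ofReal (((1 / 2 : ℝ) ^ (k + 1)) ^ (1 / p - 2)) * Φ k) ^ q := by
      intro s hs
      have hs0 : 0 < s := (hhp _).trans hs.1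
      have a1 : ∀ y : ℝ, ‖y ^ q‖ₑ ≤ ‖y‖ₑ ^ q := by
        intro y
        rw [Real.enorm_eq_ofReal_abs, Real.enorm_eq_ofReal_abs,
          ENNReal.ofReal_rpow_of_nonneg (abs_nonneg _) hq0.le]
        exact ENNReal.ofReal_le_ofReal (Real.abs_rpow_le_abs_rpow y q)
      refine (a1 _).trans (ENNReal.rpow_le_rpow ?_ hq0.le)
      rw [enorm_mul, Real.enorm_eq_ofReal (by positivity)]
      calc _ ≤ ENNReal.ofReal (s ^ (1 / p - 1)) * (ENNReal.ofReal (1 / s) *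
            ∫⁻ x, ENNReal.ofReal (|g x| - decRearr μ g s) ∂μ) := by
              gcongr
              exact s6_dr_diff hgi hs0
        _ = ENNReal.ofReal (s ^ (1 / p - 2)) *
            ∫⁻ x, ENNReal.ofReal (|g x| - decRearr μ g s) ∂μ := by
              rw [← mul_assoc, ← ENNReal.ofReal_mul (by positivity)]
              congr 2
              rw [show (1 / p - 2 : ℝ) = (1 / p - 1) - 1 by ring, Real.rpow_sub_one hs0.ne' (1 / p - 1)]
              ring
        _ ≤ _ := by
              gcongr ?_ * ?_
              · apply ENNReal.ofReal_le_ofReal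
                exact Real.rpow_le_rpow_of_nonpos (hhp _) hs.1.le (by linarith)
              · apply lintegral_mono
                intro x
                apply ENNReal.ofReal_le_ofReal
                have := s6_dr_anti hgi hs0 hs.2
                simp only [hl]
                linarith
    calc _ ≤ ∫⁻ s in Ioc ((1 / 2 : ℝ) ^ (k + 1)) ((1 / 2 : ℝ) ^ k),
          (ENNReal.ofReal (((1 / 2 : ℝ) ^ (k + 1)) ^ (1 / p - 2)) * Φ k) ^ q :=
          setLIntegral_mono' measurableSet_Ioc hpt
      _ = (ENNReal.ofReal (((1 / 2 : ℝ) ^ (k + 1)) ^ (1 / p - 2)) * Φ k) ^ q *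
          ENNReal.ofReal ((1 / 2 : ℝ) ^ (k + 1)) := by
          rw [setLIntegral_const, Real.volume_Ioc]
          congr 2
          ring
      _ = (ENNReal.ofReal (((1 / 2 : ℝ) ^ (k + 1)) ^ (1 / p - 2)) * Φ k) ^ q *
          (ENNReal.ofReal (((1 / 2 : ℝ) ^ (k + 1)) ^ (1 / q))) ^ q := by
          congr 1
          rw [ENNReal.ofReal_rpow_of_nonneg (by positivity) hq0.le,
            ← Real.rpow_mul (hhp _).le, one_div_mul_cancel hq0.ne', Real.rpow_one]
      _ = _ := by
          rw [← ENNReal.mul_rpow_of_nonneg _ _ hq0.le]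
          congr 1
          rw [mul_right_comm, ← ENNReal.ofReal_mul (by positivity),
            ← Real.rpow_add (hhp _),
            show 1 / p - 2 + 1 / q = -e by rw [he]; ring, Real.rpow_neg (hhp _).le, hhalfpow]
  have hint2 : ∀ k : ℕ, ENNReal.ofReal ((θ ^ (k + 1))⁻¹) * Φ k ≤
      ENNReal.ofReal (8 * C₀) * ∑' m, ENNReal.ofReal r ^ m * b (k + m) := by
    intro k
    calc _ ≤ ENNReal.ofReal ((θ ^ (k + 1))⁻¹) * ∑' m, ENNReal.ofReal (2 * C₀) *
            (ENNReal.ofReal (θ ^ (k + m)) * b (k + m)) := by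
          gcongr
          exact hΦle k
      _ = ∑' m, ENNReal.ofReal ((θ ^ (k + 1))⁻¹ * (2 * C₀) * θ ^ (k + m)) * b (k + m) := by
          rw [← ENNReal.tsum_mul_left]
          congr 1; ext m
          rw [ENNReal.ofReal_mul (p := (θ ^ (k + 1))⁻¹ * (2 * C₀)) (by positivity),
            ENNReal.ofReal_mul (p := (θ ^ (k + 1))⁻¹) (by positivity)]
          simp only [mul_assoc]
      _ ≤ ∑' m, ENNReal.ofReal (8 * C₀) * (ENNReal.ofReal r ^ m * b (k + m)) := by
          apply ENNReal.tsum_le_tsum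
          intro m
          rw [← mul_assoc (ENNReal.ofReal (8 * C₀)), ← ENNReal.ofReal_pow hr0.le, ← ENNReal.ofReal_mul (by positivity)]
          refine mul_le_mul_left (ENNReal.ofReal_le_ofReal ?_) _
          calc (θ ^ (k + 1))⁻¹ * (2 * C₀) * θ ^ (k + m) = θ⁻¹ * (2 * C₀) * θ ^ m := by
                rw [pow_add, pow_add]; field_simp
            _ ≤ 4 * (2 * C₀) * r ^ m := by gcongr
            _ = _ := by ring
      _ = _ := ENNReal.tsum_mul_left
  have hcover : Ioc (0 : ℝ) 1 ⊆ ⋃ k : ℕ, Ioc ((1 / 2 : ℝ) ^ (k + 1)) ((1 / 2 : ℝ) ^ k) := by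
    intro s hs
    obtain ⟨k, h1, h2⟩ := exists_nat_pow_near_of_lt_one hs.1 hs.2
      (show (0 : ℝ) < 1 / 2 by norm_num) (by norm_num)
    exact mem_iUnion.2 ⟨k, h1, h2⟩
  have hgeo : ∑' m, ENNReal.ofReal r ^ m = ENNReal.ofReal (1 - r)⁻¹ := by
    rw [ENNReal.tsum_geometric, ENNReal.ofReal_inv_of_pos (by linarith),
      ENNReal.ofReal_sub _ hr0.le, ENNReal.ofReal_one]
  calc _ ≤ ∫⁻ s in ⋃ k : ℕ, Ioc ((1 / 2 : ℝ) ^ (k + 1)) ((1 / 2 : ℝ) ^ k),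
        ‖(s ^ (1 / p - 1) * (decRearrAvg μ g s - decRearr μ g s)) ^ q‖ₑ :=
        lintegral_mono_set hcover
    _ ≤ ∑' k : ℕ, ∫⁻ s in Ioc ((1 / 2 : ℝ) ^ (k + 1)) ((1 / 2 : ℝ) ^ k),
        ‖(s ^ (1 / p - 1) * (decRearrAvg μ g s - decRearr μ g s)) ^ q‖ₑ :=
        lintegral_iUnion_le _ _
    _ ≤ ∑' k : ℕ, (ENNReal.ofReal (8 * C₀) * ∑' m, ENNReal.ofReal r ^ m * b (k + m)) ^ q :=
        ENNReal.tsum_le_tsum fun k => (hint k).trans (ENNReal.rpow_le_rpow (hint2 k) hq0.le)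
    _ = ENNReal.ofReal (8 * C₀) ^ q * ∑' k : ℕ, (∑' m, ENNReal.ofReal r ^ m * b (k + m)) ^ q := by
        rw [← ENNReal.tsum_mul_left]
        congr 1; ext k
        rw [ENNReal.mul_rpow_of_nonneg _ _ hq0.le]
    _ ≤ ENNReal.ofReal (8 * C₀) ^ q * ((∑' m, ENNReal.ofReal r ^ m) ^ q * ∑' j, b j ^ q) := by
        gcongr
        exact s6_young _ _ hq
    _ ≤ ENNReal.ofReal (8 * C₀) ^ q * (ENNReal.ofReal (1 - r)⁻¹ ^ q * ∫⁻ x, G x ^ q ∂μ) := by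
        rw [hgeo]
        gcongr
    _ = _ := by
        rw [ENNReal.ofReal_mul (p := 8 * C₀) (by positivity),
          ENNReal.mul_rpow_of_nonneg _ _ hq0.le, mul_assoc]

/-- If `Ω` satisfies the `p`-Sobolev–Poincaré inequality with constant `C₀`
(`1 < p ≤ n/(n−1)`), then there is `C = C(p, C₀)` (independent of `q`) such that
for every `q ∈ [1,∞)` and every `f ∈ W(Ω)` with `|∇f| ∈ L^q(Ω)` there exists
`c ∈ ℝ` with
`(∫₀¹ (s^{1/p−1}[(f−c)**(s) − (f−c)*(s)])^q ds)^{1/q} ≤ C (∫_Ω |∇f|^q)^{1/q}`. -/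
theorem stmt6 (p C₀ : ℝ) (hp : 1 < p) (hC₀ : 0 < C₀) :
    ∃ C : ℝ, 0 < C ∧ ∀ n : ℕ, 2 ≤ n → ∀ Ω : Set (Euc n),
      IsOpen Ω → IsConnected Ω → volume Ω = 1 → p ≤ (n : ℝ) / ((n : ℝ) - 1) →
      SPIneq Ω p C₀ →
      ∀ q : ℝ, 1 ≤ q → ∀ f : Euc n → ℝ, MemW Ω f →
        IntegrableOn (fun x => gradNorm f x ^ q) Ω →
        ∃ c : ℝ,
          (∫ s in Ioc (0 : ℝ) 1,
              (s ^ (1 / p - 1) *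
                (decRearrAvg (volume.restrict Ω) (fun x => f x - c) s
                  - decRearr (volume.restrict Ω) (fun x => f x - c) s)) ^ q) ^ (1 / q)
            ≤ C * (∫ x in Ω, gradNorm f x ^ q) ^ (1 / q) := by
  have hp0 : 0 < p := by linarith
  have hpinv : 0 < 1 - 1 / p := by
    rw [sub_pos, div_lt_one hp0]; exact hp
  have hr1 : (1 / 2 : ℝ) ^ (1 - 1 / p) < 1 :=
    Real.rpow_lt_one (by norm_num) (by norm_num) hpinv
  have hCpos : 0 < 8 * C₀ * (1 - (1 / 2 : ℝ) ^ (1 - 1 / p))⁻¹ := by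
    have : 0 < 1 - (1 / 2 : ℝ) ^ (1 - 1 / p) := by linarith
    positivity
  refine ⟨8 * C₀ * (1 - (1 / 2 : ℝ) ^ (1 - 1 / p))⁻¹, hCpos, ?_⟩
  intro n _ Ω ho _ hv _ hSP q hq f hf hfq
  have hq0 : 0 < q := by linarith
  have : IsProbabilityMeasure (volume.restrict Ω) := ⟨by simp [hv]⟩
  obtain ⟨c, hc1, hc2⟩ := s6_median (μ := volume.restrict Ω) (u := f) hf.2.1
  refine ⟨c, ?_⟩
  obtain ⟨hg, hgg⟩ := s6_memW_sub hf hv c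
  have hmain := s6_main ho hv hp hC₀ hq hSP hg (by simpa using hc1) (by simpa using hc2)
  rw [hgg] at hmain
  set C := 8 * C₀ * (1 - (1 / 2 : ℝ) ^ (1 - 1 / p))⁻¹ with hC
  set I := ∫ s in Ioc (0 : ℝ) 1,
              (s ^ (1 / p - 1) *
                (decRearrAvg (volume.restrict Ω) (fun x => f x - c) s
                  - decRearr (volume.restrict Ω) (fun x => f x - c) s)) ^ q with hI
  set J := ∫ x in Ω, gradNorm f x ^ q with hJ
  have hJ0 : 0 ≤ J := integral_nonneg fun x => Real.rpow_nonneg (norm_nonneg _) _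
  have hJl : ∫⁻ x in Ω, ENNReal.ofReal (gradNorm f x) ^ q = ENNReal.ofReal J := by
    rw [hJ, ofReal_integral_eq_lintegral_ofReal hfq
      (Filter.Eventually.of_forall fun x => Real.rpow_nonneg (norm_nonneg _) _)]
    congr 1; ext x
    exact ENNReal.ofReal_rpow_of_nonneg (norm_nonneg _) hq0.le
  have hIl : ‖I‖ₑ ≤ ENNReal.ofReal (C ^ q * J) := by
    refine (enorm_integral_le_lintegral_enorm _).trans (hmain.trans ?_)
    rw [hJl, ENNReal.ofReal_rpow_of_nonneg hCpos.le hq0.le, ← ENNReal.ofReal_mul (by positivity)]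
  rw [Real.enorm_eq_ofReal_abs, ENNReal.ofReal_le_ofReal_iff (by positivity)] at hIl
  calc I ^ (1 / q) ≤ |I| ^ (1 / q) :=
        (le_abs_self _).trans (Real.abs_rpow_le_abs_rpow _ _)
    _ ≤ (C ^ q * J) ^ (1 / q) := Real.rpow_le_rpow (abs_nonneg _) hIl (by positivity)
    _ = C * J ^ (1 / q) := by
        rw [Real.mul_rpow (by positivity) hJ0, ← Real.rpow_mul hCpos.le,
          mul_one_div_cancel hq0.ne', Real.rpow_one]
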